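/- arXiv:cs/0412061 — 8 statements merged into one kernel-verified Lean document; each statement's English description precedes it below -/
import Mathlib

section
/- Semi-distributivity: for all n, m, p ∈ ℕ and σ ∈ Perm (Fin n), τ ∈ Perm (Fin m), π ∈ Perm (Fin p), transporting along the canonical equivalence finCongr : Fin (n·(m+p)) ≃ Fin (n·m + n·p) induced by the equality n·(m+p) = n·m + n·p, one has σ ⊠ (τ →⁺ π) = (σ ⊠ τ) →⁺ (σ ⊠ π). -/
/-- The intransitive product `σ →⁺ τ` of two permutations: the conjugate of
`Equiv.sumCongr σ τ` by the canonical equivalence `finSumFinEquiv`. -/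
def intransitive {n m : ℕ} (σ : Equiv.Perm (Fin n)) (τ : Equiv.Perm (Fin m)) :
    Equiv.Perm (Fin (n + m)) :=
  Equiv.permCongr finSumFinEquiv (Equiv.sumCongr σ τ)

/-- The equivalence `Fin n × Fin m ≃ Fin (n * m)` sending `(j, k)` to `j + n * k`. -/
def gridEquiv (n m : ℕ) : Fin n × Fin m ≃ Fin (n * m) :=
  (Equiv.prodComm (Fin n) (Fin m)).trans (finProdFinEquiv.trans (finCongr (Nat.mul_comm m n)))

/-- The Cartesian product `σ ⊠ τ` of two permutations: the conjugate of
`Equiv.prodCongr σ τ` by the equivalence `Fin n × Fin m ≃ Fin (n * m)`, `(j,k) ↦ j + n·k`. -/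
def cartesian {n m : ℕ} (σ : Equiv.Perm (Fin n)) (τ : Equiv.Perm (Fin m)) :
    Equiv.Perm (Fin (n * m)) :=
  Equiv.permCongr (gridEquiv n m) (Equiv.prodCongr σ τ)

theorem finCongr_gridEquiv_castAdd {n m p : ℕ} (j : Fin n) (k : Fin m) :
    finCongr (Nat.left_distrib n m p) (gridEquiv n (m + p) (j, Fin.castAdd p k))
      = Fin.castAdd (n * p) (gridEquiv n m (j, k)) := by
  ext
  simp [gridEquiv]

theorem finCongr_gridEquiv_natAdd {n m p : ℕ} (j : Fin n) (k : Fin p) :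
    finCongr (Nat.left_distrib n m p) (gridEquiv n (m + p) (j, Fin.natAdd m k))
      = Fin.natAdd (n * m) (gridEquiv n p (j, k)) := by
  ext
  simp [gridEquiv]
  ring

theorem cartesian_gridEquiv {n m : ℕ} (σ : Equiv.Perm (Fin n)) (τ : Equiv.Perm (Fin m))
    (j : Fin n) (k : Fin m) :
    cartesian σ τ (gridEquiv n m (j, k)) = gridEquiv n m (σ j, τ k) := by
  simp [cartesian, Equiv.permCongr_apply]

theorem intransitive_castAdd {n m : ℕ} (σ : Equiv.Perm (Fin n)) (τ : Equiv.Perm (Fin m))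
    (j : Fin n) : intransitive σ τ (Fin.castAdd m j) = Fin.castAdd m (σ j) := by
  simp [intransitive, Equiv.permCongr_apply]

theorem intransitive_natAdd {n m : ℕ} (σ : Equiv.Perm (Fin n)) (τ : Equiv.Perm (Fin m))
    (k : Fin m) : intransitive σ τ (Fin.natAdd n k) = Fin.natAdd n (τ k) := by
  simp [intransitive, Equiv.permCongr_apply]

/-- Semi-distributivity: `σ ⊠ (τ →⁺ π) = (σ ⊠ τ) →⁺ (σ ⊠ π)`, up to the canonical
identification `Fin (n·(m+p)) ≃ Fin (n·m + n·p)`. -/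
theorem cartesian_semidistrib (n m p : ℕ) (σ : Equiv.Perm (Fin n)) (τ : Equiv.Perm (Fin m))
    (π : Equiv.Perm (Fin p)) :
    Equiv.permCongr (finCongr (Nat.left_distrib n m p))
        (cartesian σ (intransitive τ π))
      = intransitive (cartesian σ τ) (cartesian σ π) := by
  refine Equiv.ext fun x => ?_
  obtain ⟨y, rfl⟩ := (finCongr (Nat.left_distrib n m p)).surjective x
  obtain ⟨⟨j, k⟩, rfl⟩ := (gridEquiv n (m + p)).surjective y
  rw [Equiv.permCongr_apply, Equiv.symm_apply_apply, cartesian_gridEquiv]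
  induction k using Fin.addCases with
  | left k =>
    rw [intransitive_castAdd, finCongr_gridEquiv_castAdd, finCongr_gridEquiv_castAdd,
      intransitive_castAdd, cartesian_gridEquiv]
  | right k =>
    rw [intransitive_natAdd, finCongr_gridEquiv_natAdd, finCongr_gridEquiv_natAdd,
      intransitive_natAdd, cartesian_gridEquiv]
end

section
/- Let α and β be nonempty finite types, σ ∈ Perm α and τ ∈ Perm β be such that the cyclic group ⟨σ⟩ acts transitively on α and ⟨τ⟩ acts transitively on β (i.e. σ and τ each consist of a single cycle covering all points). Set l = Fintype.card α and l' = Fintype.card β. Then every orbit of the cyclic group generated by Equiv.prodCongr σ τ acting on α × β has cardinality lcm(l, l'), and the number of such orbits is gcd(l, l'). (The Cartesian product of an l-cycle and an l'-cycle produces gcd(l,l') cycles of length lcm(l,l').) -/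
open MulAction in
theorem Equiv.Perm.minimalPeriod_eq_natCard_orbit {γ : Type*} [Finite γ]
    (π : Equiv.Perm γ) (x : γ) :
    Function.minimalPeriod π x = Nat.card (orbit (Subgroup.zpowers π) x) := by
  have := Fintype.ofFinite (orbit (Subgroup.zpowers π) x)
  rw [Nat.card_eq_fintype_card]
  exact minimalPeriod_eq_card (a := π) (b := x)

theorem Equiv.Perm.minimalPeriod_eq_card_of_isPretransitive {γ : Type*} [Fintype γ]
    (π : Equiv.Perm γ) (h : MulAction.IsPretransitive (Subgroup.zpowers π) γ) (x : γ) :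
    Function.minimalPeriod π x = Fintype.card γ := by
  rw [π.minimalPeriod_eq_natCard_orbit, MulAction.orbit_eq_univ, Nat.card_univ,
    Nat.card_eq_fintype_card]

/-- The Cartesian product of a single `l`-cycle and a single `l'`-cycle (i.e. permutations
whose cyclic groups act transitively) produces `gcd(l,l')` cycles of length `lcm(l,l')`. -/
theorem prodCongr_cycle_orbits {α β : Type*} [Fintype α] [Fintype β] [Nonempty α] [Nonempty β]
    (σ : Equiv.Perm α) (τ : Equiv.Perm β)
    (hσ : MulAction.IsPretransitive (Subgroup.zpowers σ) α)
    (hτ : MulAction.IsPretransitive (Subgroup.zpowers τ) β) :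
    (∀ ω : MulAction.orbitRel.Quotient (Subgroup.zpowers (Equiv.prodCongr σ τ)) (α × β),
        Nat.card ω.orbit = Nat.lcm (Fintype.card α) (Fintype.card β)) ∧
      Nat.card (MulAction.orbitRel.Quotient (Subgroup.zpowers (Equiv.prodCongr σ τ)) (α × β))
        = Nat.gcd (Fintype.card α) (Fintype.card β) := by
  have hcard : ∀ ω : MulAction.orbitRel.Quotient
      (Subgroup.zpowers (Equiv.prodCongr σ τ)) (α × β),
      Nat.card ω.orbit = Nat.lcm (Fintype.card α) (Fintype.card β) := by
    intro ω
    induction ω using Quotient.inductionOn' with | _ p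
    rw [MulAction.orbitRel.Quotient.orbit_mk, ← Equiv.Perm.minimalPeriod_eq_natCard_orbit,
      Equiv.prodCongr_apply, Function.minimalPeriod_prodMap,
      σ.minimalPeriod_eq_card_of_isPretransitive hσ,
      τ.minimalPeriod_eq_card_of_isPretransitive hτ]
  refine ⟨hcard, ?_⟩
  have hsum := Nat.card_congr (MulAction.selfEquivSigmaOrbits'
    (Subgroup.zpowers (Equiv.prodCongr σ τ)) (α × β))
  have := Fintype.ofFinite (MulAction.orbitRel.Quotient
    (Subgroup.zpowers (Equiv.prodCongr σ τ)) (α × β))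
  rw [Nat.card_sigma, Finset.sum_congr rfl fun ω _ => hcard ω, Finset.sum_const,
    Finset.card_univ, ← Nat.card_eq_fintype_card, smul_eq_mul, Nat.card_prod,
    Nat.card_eq_fintype_card (α := α), Nat.card_eq_fintype_card (α := β),
    ← Nat.gcd_mul_lcm] at hsum
  exact (Nat.eq_of_mul_eq_mul_right
    (Nat.lcm_pos Fintype.card_pos Fintype.card_pos) hsum).symm
end

section
/- Let α and β be finite types, σ ∈ Perm α, τ ∈ Perm β. For every integer r ≥ 1, the number of orbits of cardinality r of the cyclic group generated by Equiv.prodCongr σ τ acting on α × β satisfies c_r(Equiv.prodCongr σ τ) = Σ_{(p,q) : p,q ≥ 1, lcm(p,q) = r} gcd(p,q) · c_p(σ) · c_q(τ), the sum ranging over the (finitely many) pairs of positive integers (p, q) with lcm(p, q) = r. -/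
/-- `cycCount π j` is the number of orbits of cardinality `j` of the cyclic subgroup
generated by `π` acting on `γ` (fixed points count as orbits of size `1`). -/
noncomputable def cycCount {γ : Type*} [Fintype γ] (π : Equiv.Perm γ) (j : ℕ) : ℕ :=
  Nat.card {ω : MulAction.orbitRel.Quotient (Subgroup.zpowers π) γ // Nat.card ω.orbit = j}

open Function MulAction in
theorem card_quotient_orbit_eq_minimalPeriod {γ : Type*} [Finite γ] (π : Equiv.Perm γ) (x : γ) :
    Nat.card (orbitRel.Quotient.orbit
      (Quotient.mk'' x : orbitRel.Quotient (Subgroup.zpowers π) γ)) = minimalPeriod π x := by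
  have := Fintype.ofFinite (orbit (Subgroup.zpowers π) x)
  rw [orbitRel.Quotient.orbit_mk, Nat.card_eq_fintype_card]
  exact (minimalPeriod_eq_card (a := π) (b := x)).symm

open Function MulAction in
/-- The points of minimal period `j` are partitioned into the orbits of cardinality `j`. -/
theorem card_minimalPeriod_eq_mul_cycCount {γ : Type*} [Fintype γ] (π : Equiv.Perm γ) (j : ℕ) :
    Nat.card {x : γ // minimalPeriod π x = j} = j * cycCount π j := by
  classical
  let f : {x : γ // minimalPeriod π x = j} →
      {ω : orbitRel.Quotient (Subgroup.zpowers π) γ // Nat.card ω.orbit = j} :=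
    fun x => ⟨Quotient.mk'' x.1, (card_quotient_orbit_eq_minimalPeriod π x.1).trans x.2⟩
  have hfiber (ω) : Nat.card {x // f x = ω} = j := by
    refine Eq.trans (Nat.card_congr ?_) ω.2
    refine
      { toFun := fun x => ⟨x.1.1, orbitRel.Quotient.mem_orbit.2 (congrArg Subtype.val x.2)⟩
        invFun := fun y => ⟨⟨y.1, ?_⟩, Subtype.ext (orbitRel.Quotient.mem_orbit.1 y.2)⟩
        left_inv := fun _ => rfl
        right_inv := fun _ => rfl }
    rw [← card_quotient_orbit_eq_minimalPeriod, orbitRel.Quotient.mem_orbit.1 y.2, ω.2]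
  have := Fintype.ofFinite
    {ω : orbitRel.Quotient (Subgroup.zpowers π) γ // Nat.card ω.orbit = j}
  rw [← Nat.card_congr (Equiv.sigmaFiberEquiv f), Nat.card_sigma]
  simp only [hfiber, Finset.sum_const, Finset.card_univ, smul_eq_mul, cycCount,
    Nat.card_eq_fintype_card, mul_comm]

/-- The cycle structure of a Cartesian (componentwise) product:
`c_r(σ × τ) = Σ_{lcm(p,q) = r} gcd(p,q) · c_p(σ) · c_q(τ)`, the sum ranging over the
pairs of positive integers `(p, q)` with `lcm(p, q) = r` (all of which satisfy
`p, q ≤ r`). -/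
theorem cycCount_prodCongr {α β : Type*} [Fintype α] [Fintype β]
    (σ : Equiv.Perm α) (τ : Equiv.Perm β) (r : ℕ) (hr : 1 ≤ r) :
    cycCount (Equiv.prodCongr σ τ) r
      = ∑ pq ∈ (Finset.Icc 1 r ×ˢ Finset.Icc 1 r).filter
          (fun pq => Nat.lcm pq.1 pq.2 = r),
          Nat.gcd pq.1 pq.2 * cycCount σ pq.1 * cycCount τ pq.2 := by
  classical
  refine Nat.eq_of_mul_eq_mul_left hr ?_
  rw [← card_minimalPeriod_eq_mul_cycCount, Nat.card_eq_fintype_card, Fintype.card_subtype,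
    Finset.mul_sum, Finset.card_eq_sum_card_fiberwise
      (f := fun x : α × β => (Function.minimalPeriod σ x.1, Function.minimalPeriod τ x.2))
      (t := (Finset.Icc 1 r ×ˢ Finset.Icc 1 r).filter (fun pq => Nat.lcm pq.1 pq.2 = r))]
  · refine Finset.sum_congr rfl fun pq hpq => ?_
    obtain ⟨p, q⟩ := pq
    have hlcm : p.lcm q = r := (Finset.mem_filter.1 hpq).2
    calc _ = Nat.card ({x // Function.minimalPeriod σ x = p} ×
            {y // Function.minimalPeriod τ y = q}) := by
          rw [Nat.card_prod, Nat.card_eq_fintype_card, Nat.card_eq_fintype_card,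
            Fintype.card_subtype, Fintype.card_subtype, ← Finset.card_product]
          congr 1
          ext ⟨x, y⟩
          simp only [Finset.mem_filter, Finset.mem_univ, true_and, Finset.mem_product,
            Prod.mk.injEq, Equiv.prodCongr_apply, Function.minimalPeriod_prodMap]
          exact and_iff_right_of_imp fun h => by rw [h.1, h.2, hlcm]
      _ = (p.gcd q * p.lcm q) * (cycCount σ p * cycCount τ q) := by
          rw [Nat.card_prod, card_minimalPeriod_eq_mul_cycCount,
            card_minimalPeriod_eq_mul_cycCount, Nat.gcd_mul_lcm]
          ring
      _ = _ := by rw [hlcm]; ring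
  · rintro ⟨x, y⟩ hxy
    have hlcm : (Function.minimalPeriod σ x).lcm (Function.minimalPeriod τ y) = r := by
      simpa [Function.minimalPeriod_prodMap] using hxy
    have hp := hlcm ▸ Nat.dvd_lcm_left (Function.minimalPeriod σ x) (Function.minimalPeriod τ y)
    have hq := hlcm ▸ Nat.dvd_lcm_right (Function.minimalPeriod σ x) (Function.minimalPeriod τ y)
    simp only [Finset.coe_filter, Finset.mem_product, Finset.mem_Icc, Set.mem_ofPred_eq]
    exact ⟨⟨⟨Nat.pos_of_dvd_of_pos hp hr, Nat.le_of_dvd hr hp⟩,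
      Nat.pos_of_dvd_of_pos hq hr, Nat.le_of_dvd hr hq⟩, hlcm⟩
end

section
/- For all natural numbers i, j, k: gcd(i, j) · gcd(lcm(i, j), k) = gcd(j, k) · gcd(i, lcm(j, k)). (Together with the associativity of lcm, this identity expresses the associativity of the product ψ_i ⋆ ψ_j = ψ_{lcm(i,j)}^{gcd(i,j)} on power sums.) -/
/-- The gcd/lcm identity `gcd(i,j) · gcd(lcm(i,j), k) = gcd(j,k) · gcd(i, lcm(j,k))`,
which (together with associativity of `lcm`) expresses the associativity of the product
`ψ_i ⋆ ψ_j = ψ_{lcm(i,j)}^{gcd(i,j)}` on power sums. -/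
theorem gcd_lcm_assoc (i j k : ℕ) :
    Nat.gcd i j * Nat.gcd (Nat.lcm i j) k = Nat.gcd j k * Nat.gcd i (Nat.lcm j k) := by
  rw [← Nat.gcd_mul_left, Nat.gcd_mul_lcm, ← Nat.gcd_mul_right i k j,
    ← Nat.gcd_mul_left (Nat.gcd j k) i, Nat.gcd_mul_lcm, ← Nat.gcd_mul_right j i k,
    Nat.gcd_assoc, Nat.mul_comm j i, Nat.mul_comm k i]
end

section
/- Cycle index of the symmetric group: for every commutative ring R, finite type ι, and n ∈ ℕ, Σ_{σ ∈ Perm (Fin n)} 𝔷(σ) = n! • h_n in MvPolynomial ι R, where h_n is the complete homogeneous symmetric polynomial of degree n in the variables ι (the sum, over all monomials of degree n, of those monomials). Equivalently, over ℚ the cycle index polynomial Z(S_n) = (1/n!) Σ_{σ ∈ S_n} ∏_j p_j^{c_j(σ)} equals h_n. -/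
/-- The cycle-index map `𝔷(π) = ∏_{j ≥ 1} (p_j)^{c_j(π)}`, where `p_j` is the `j`-th
power-sum symmetric polynomial. -/
noncomputable def cycleIndex (ι R : Type*) [Fintype ι] [CommRing R]
    {γ : Type*} [Fintype γ] (π : Equiv.Perm γ) : MvPolynomial ι R :=
  ∏ j ∈ Finset.Icc 1 (Fintype.card γ), (MvPolynomial.psum ι R j) ^ (cycCount π j)

theorem cycleIndex_eq_prod_orbits (ι R : Type*) [Fintype ι] [CommRing R] {γ : Type*} [Fintype γ]
    (π : Equiv.Perm γ) [Fintype (MulAction.orbitRel.Quotient (Subgroup.zpowers π) γ)] :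
    cycleIndex ι R π = ∏ ω : MulAction.orbitRel.Quotient (Subgroup.zpowers π) γ,
      MvPolynomial.psum ι R (Nat.card ω.orbit) := by
  classical
  have hmem : ∀ ω ∈ (Finset.univ : Finset (MulAction.orbitRel.Quotient (Subgroup.zpowers π) γ)),
      Nat.card ω.orbit ∈ Finset.Icc 1 (Fintype.card γ) := by
    intro ω _
    have : Nonempty ω.orbit := (MulAction.orbitRel.Quotient.nonempty_orbit ω).to_subtype
    rw [Finset.mem_Icc, ← Nat.card_eq_fintype_card]
    exact ⟨Nat.card_pos, Nat.card_le_card_of_injective _ Subtype.val_injective⟩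
  rw [cycleIndex, ← Finset.prod_fiberwise_of_maps_to hmem]
  refine Finset.prod_congr rfl fun j _ => ?_
  rw [Finset.prod_congr rfl fun ω hω => by rw [(Finset.mem_filter.1 hω).2], Finset.prod_const,
    cycCount, Nat.card_eq_fintype_card, Fintype.card_subtype]

theorem cycleIndex_eq_sum_invariant (ι R : Type*) [Fintype ι] [CommRing R]
    {γ : Type*} [Fintype γ] [DecidableEq γ] [DecidableEq ι] (π : Equiv.Perm γ) :
    cycleIndex ι R π = ∑ f : γ → ι with f ∘ π = f, ∏ x, MvPolynomial.X (f x) := by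
  classical
  have : Fintype (MulAction.orbitRel.Quotient (Subgroup.zpowers π) γ) := Fintype.ofFinite _
  simp only [cycleIndex_eq_prod_orbits, MvPolynomial.psum, Finset.prod_univ_sum,
    Fintype.piFinset_univ]
  have hmk (x : γ) : (Quotient.mk'' (π x) : MulAction.orbitRel.Quotient (Subgroup.zpowers π) γ)
      = Quotient.mk'' x :=
    Quotient.sound' ⟨⟨π, Subgroup.mem_zpowers π⟩, rfl⟩
  refine Finset.sum_nbij (fun g x => g (Quotient.mk'' x)) ?_ ?_ ?_ ?_
  · intro g _
    simp only [Finset.mem_filter, Finset.mem_univ, true_and]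
    funext x
    simp [hmk]
  · intro g _ g' _ h
    funext ω
    induction ω using Quotient.inductionOn' with
    | h x => exact congrFun h x
  · intro f hf
    simp only [Finset.coe_filter, Finset.mem_univ, true_and, Set.mem_ofPred_eq] at hf
    have hinv (k : Subgroup.zpowers π) (x : γ) : f (k • x) = f x := by
      obtain ⟨k, m, rfl⟩ := k
      have hπ : DomMulAct.mk π ∈ MulAction.stabilizer (Equiv.Perm γ)ᵈᵐᵃ f := hf
      exact congrFun (zpow_mem hπ m) x
    refine ⟨fun ω => Quotient.liftOn' ω f ?_, by simp, rfl⟩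
    rintro a b ⟨k, rfl⟩
    exact hinv k b
  · intro g _
    rw [← Finset.prod_fiberwise (s := Finset.univ)
      (g := fun x => (Quotient.mk'' x : MulAction.orbitRel.Quotient (Subgroup.zpowers π) γ))]
    refine Finset.prod_congr rfl fun ω _ => ?_
    rw [Finset.prod_congr rfl fun x hx =>
      congrArg (fun ω => MvPolynomial.X (g ω)) (Finset.mem_filter.1 hx).2, Finset.prod_const]
    congr 1
    rw [← Fintype.card_subtype, ← Nat.card_eq_fintype_card]
    exact Nat.card_congr (Equiv.subtypeEquivRight fun x =>
      MulAction.orbitRel.Quotient.mem_orbit)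

theorem exists_map_univ_eq {ι : Type*} {n : ℕ} (s : Sym ι n) :
    ∃ f : Fin n → ι, Finset.univ.val.map f = s.1 := by
  obtain ⟨s, rfl⟩ := s
  induction s using Quotient.inductionOn with
  | h l => exact ⟨l.get, (Fin.univ_val_map l.get).trans (congrArg _ (List.ofFn_get l))⟩

theorem exists_perm_comp_eq_iff {ι γ : Type*} [Fintype γ] (f g : γ → ι) :
    (∃ τ : Equiv.Perm γ, g ∘ τ = f) ↔ Finset.univ.val.map f = Finset.univ.val.map g := by
  classical
  constructor
  · rintro ⟨τ, rfl⟩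
    rw [← Multiset.map_map, Multiset.map_univ_val_equiv]
  · intro h
    have hcard (i : ι) : Fintype.card {x // f x = i} = Fintype.card {x // g x = i} := by
      have := congrArg (Multiset.count i) h
      simpa only [Multiset.count_map, Fintype.card_subtype, Finset.card, Finset.filter_val,
        eq_comm] using this
    let e (i : ι) : {x // f x = i} ≃ {x // g x = i} := Fintype.equivOfCardEq (hcard i)
    exact ⟨Equiv.ofFiberEquiv e, funext fun x => Equiv.ofFiberEquiv_map e x⟩

theorem card_perm_comp_eq_of_comp_eq {ι γ : Type*} [Fintype γ] [DecidableEq γ] [DecidableEq ι]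
    {f g : γ → ι} {τ : Equiv.Perm γ} (h : g ∘ τ = f) :
    Fintype.card {σ : Equiv.Perm γ // f ∘ σ = f} = Fintype.card {σ : Equiv.Perm γ // g ∘ σ = f} :=
  Fintype.card_congr <| (Equiv.mulLeft τ).subtypeEquiv fun σ => by
    subst h; rfl

theorem sum_card_perm_comp_eq {ι : Type*} [Fintype ι] [DecidableEq ι] {n : ℕ} (s : Sym ι n) :
    ∑ f : Fin n → ι with Finset.univ.val.map f = s.1,
      Fintype.card {σ : Equiv.Perm (Fin n) // f ∘ σ = f} = n.factorial := by
  obtain ⟨g, hg⟩ := exists_map_univ_eq s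
  have key : ∀ f ∈ (Finset.univ.filter fun f : Fin n → ι => Finset.univ.val.map f = s.1),
      Fintype.card {σ : Equiv.Perm (Fin n) // f ∘ σ = f} =
        (Finset.univ.filter fun σ : Equiv.Perm (Fin n) => g ∘ σ = f).card := by
    intro f hf
    obtain ⟨τ, hτ⟩ := (exists_perm_comp_eq_iff f g).2 ((Finset.mem_filter.1 hf).2.trans hg.symm)
    rw [card_perm_comp_eq_of_comp_eq hτ, Fintype.card_subtype]
  rw [Finset.sum_congr rfl key, ← Finset.card_eq_sum_card_fiberwise]
  · simp [Fintype.card_perm]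
  · intro σ _
    rw [Finset.mem_coe, Finset.mem_filter, ← hg]
    exact ⟨Finset.mem_univ _, (exists_perm_comp_eq_iff _ g).1 ⟨σ, rfl⟩⟩

/-- Cycle index of the symmetric group: `Σ_{σ ∈ S_n} 𝔷(σ) = n! • h_n`, i.e. over `ℚ`
the cycle index polynomial `Z(S_n)` is the complete homogeneous symmetric polynomial. -/
theorem cycleIndex_symmetricGroup (R : Type*) [CommRing R] (ι : Type*) [Fintype ι]
    [DecidableEq ι] (n : ℕ) :
    ∑ σ : Equiv.Perm (Fin n), cycleIndex ι R σ = (Nat.factorial n) • MvPolynomial.hsymm ι R n := by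
  simp only [cycleIndex_eq_sum_invariant, Finset.sum_filter]
  rw [Finset.sum_comm, MvPolynomial.hsymm, Finset.smul_sum,
    ← Finset.sum_fiberwise (s := Finset.univ)
      (g := fun f : Fin n → ι => (Sym.mk (Finset.univ.val.map f) (by simp) : Sym ι n))]
  refine Finset.sum_congr rfl fun s _ => ?_
  rw [← sum_card_perm_comp_eq s, Finset.sum_smul]
  refine Finset.sum_congr (Finset.filter_congr fun f _ => Subtype.ext_iff) fun f hf => ?_
  rw [← Finset.sum_filter, Finset.sum_const, ← Fintype.card_subtype,
    ← (Finset.mem_filter.1 hf).2, Multiset.map_map]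
  rfl
end

section
/- Multiplicativity of the cycle index polynomial on intransitive products of permutation groups: let R be a commutative ring, ι a finite type, G₁ a subgroup of Perm (Fin n) and G₂ a subgroup of Perm (Fin m). Then Σ_{σ ∈ G₁} Σ_{τ ∈ G₂} 𝔷(σ →⁺ τ) = (Σ_{σ ∈ G₁} 𝔷(σ)) · (Σ_{τ ∈ G₂} 𝔷(τ)) in MvPolynomial ι R. Equivalently, over ℚ, Z(G₁ →⁺ G₂) = Z(G₁) · Z(G₂), where Z(G) = (1/|G|) Σ_{σ ∈ G} 𝔷(σ). -/
theorem Function.Semiconj.image_orbit_zpowers {α γ : Type*} {σ : Equiv.Perm α}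
    {π : Equiv.Perm γ} {f : α → γ} (h : Function.Semiconj f σ π) (x : α) :
    f '' MulAction.orbit (Subgroup.zpowers σ) x =
      MulAction.orbit (Subgroup.zpowers π) (f x) := by
  have hz (k : ℤ) (y : α) : f ((σ ^ k) y) = (π ^ k) (f y) := by
    induction k generalizing y with
    | zero => rfl
    | succ k ih => rw [zpow_add_one, zpow_add_one, Equiv.Perm.mul_apply, ih, h y]; rfl
    | pred k ih =>
      rw [zpow_sub_one, zpow_sub_one, Equiv.Perm.mul_apply, ih, Equiv.Perm.mul_apply]
      congr 1
      rw [Equiv.Perm.eq_inv_iff_eq, ← h, ← Equiv.Perm.mul_apply, mul_inv_cancel,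
        Equiv.Perm.one_apply]
  ext y
  constructor
  · rintro ⟨_, ⟨⟨_, k, rfl⟩, rfl⟩, rfl⟩
    exact ⟨⟨π ^ k, k, rfl⟩, (hz k x).symm⟩
  · rintro ⟨⟨_, k, rfl⟩, rfl⟩
    exact ⟨_, ⟨⟨σ ^ k, k, rfl⟩, rfl⟩, hz k x⟩

theorem cycCount_eq_ncard {γ : Type*} [Fintype γ] (π : Equiv.Perm γ) (j : ℕ) :
    cycCount π j =
      {s ∈ Set.range fun x : γ => MulAction.orbit (Subgroup.zpowers π) x | s.ncard = j}.ncard := by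
  rw [cycCount, ← Nat.card_coe_set_eq]
  refine Nat.card_congr (Equiv.ofBijective (fun ω => ⟨ω.1.orbit, ?_, ω.2⟩) ⟨?_, ?_⟩)
  · obtain ⟨ω, -⟩ := ω
    induction ω using Quotient.inductionOn'
    exact ⟨_, rfl⟩
  · intro ω₁ ω₂ h
    exact Subtype.ext (MulAction.orbitRel.Quotient.orbit_injective (congrArg Subtype.val h))
  · rintro ⟨_, ⟨x, rfl⟩, hx⟩
    exact ⟨⟨Quotient.mk'' x, hx⟩, rfl⟩

theorem cycCount_eq_zero_of_card_lt {γ : Type*} [Fintype γ] (π : Equiv.Perm γ) {j : ℕ}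
    (hj : Fintype.card γ < j) : cycCount π j = 0 := by
  rw [cycCount_eq_ncard, Set.ncard_eq_zero, Set.eq_empty_iff_forall_notMem]
  rintro s ⟨-, rfl⟩
  exact hj.not_ge (Nat.card_eq_fintype_card (α := γ) ▸ Set.ncard_le_card s)

theorem cycCount_eq_add {α β γ : Type*} [Fintype α] [Fintype β] [Fintype γ]
    {σ : Equiv.Perm α} {τ : Equiv.Perm β} {π : Equiv.Perm γ} {f : α → γ} {g : β → γ}
    (hf : Function.Injective f) (hg : Function.Injective g)
    (hfg : IsCompl (Set.range f) (Set.range g))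
    (hσ : Function.Semiconj f σ π) (hτ : Function.Semiconj g τ π) (j : ℕ) :
    cycCount π j = cycCount σ j + cycCount τ j := by
  simp only [cycCount_eq_ncard]
  rw [← Set.ncard_image_of_injective _ hf.image_injective,
    ← Set.ncard_image_of_injective _ hg.image_injective, ← Set.ncard_union_eq]
  · congr 1
    ext s
    constructor
    · rintro ⟨⟨z, rfl⟩, hs⟩
      obtain ⟨x, rfl⟩ | ⟨y, rfl⟩ : z ∈ Set.range f ∪ Set.range g :=
        hfg.sup_eq_top.ge (Set.mem_univ z)
      · refine .inl ⟨_, ⟨⟨x, rfl⟩, ?_⟩, hσ.image_orbit_zpowers x⟩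
        rwa [← Set.ncard_image_of_injective _ hf, hσ.image_orbit_zpowers]
      · refine .inr ⟨_, ⟨⟨y, rfl⟩, ?_⟩, hτ.image_orbit_zpowers y⟩
        rwa [← Set.ncard_image_of_injective _ hg, hτ.image_orbit_zpowers]
    · rintro (⟨_, ⟨⟨x, rfl⟩, hs⟩, rfl⟩ | ⟨_, ⟨⟨y, rfl⟩, hs⟩, rfl⟩)
      · exact ⟨⟨f x, (hσ.image_orbit_zpowers x).symm⟩,
          (Set.ncard_image_of_injective _ hf).trans hs⟩
      · exact ⟨⟨g y, (hτ.image_orbit_zpowers y).symm⟩,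
          (Set.ncard_image_of_injective _ hg).trans hs⟩
  · rw [Set.disjoint_left]
    rintro _ ⟨_, ⟨⟨x, rfl⟩, -⟩, rfl⟩ ⟨t, -, ht⟩
    have hx : f x ∈ g '' t := by
      rw [ht]
      exact Set.mem_image_of_mem f (MulAction.mem_orbit_self x)
    exact Set.disjoint_left.1 hfg.disjoint ⟨x, rfl⟩ (Set.image_subset_range g t hx)

theorem cycCount_intransitive {n m : ℕ} (σ : Equiv.Perm (Fin n)) (τ : Equiv.Perm (Fin m))
    (j : ℕ) : cycCount (intransitive σ τ) j = cycCount σ j + cycCount τ j := by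
  refine cycCount_eq_add (f := finSumFinEquiv ∘ Sum.inl) (g := finSumFinEquiv ∘ Sum.inr)
    (finSumFinEquiv.injective.comp Sum.inl_injective)
    (finSumFinEquiv.injective.comp Sum.inr_injective) ?_ ?_ ?_ j
  · rw [Set.range_comp, Set.range_comp, ← Set.isCompl_range_inl_range_inr.compl_eq,
      Set.image_compl_eq finSumFinEquiv.bijective]
    exact isCompl_compl
  · intro x
    simp [intransitive, -finSumFinEquiv_apply_left]
  · intro x
    simp [intransitive, -finSumFinEquiv_apply_right]

theorem cycleIndex_eq_prod_Icc (ι R : Type*) [Fintype ι] [CommRing R] {γ : Type*} [Fintype γ]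
    (π : Equiv.Perm γ) {N : ℕ} (hN : Fintype.card γ ≤ N) :
    cycleIndex ι R π = ∏ j ∈ Finset.Icc 1 N, MvPolynomial.psum ι R j ^ cycCount π j := by
  refine Finset.prod_subset (Finset.Icc_subset_Icc_right hN) fun j hj hj' => ?_
  rw [cycCount_eq_zero_of_card_lt π (by simp_all), pow_zero]

theorem cycleIndex_intransitive (ι R : Type*) [Fintype ι] [CommRing R] {n m : ℕ}
    (σ : Equiv.Perm (Fin n)) (τ : Equiv.Perm (Fin m)) :
    cycleIndex ι R (intransitive σ τ) = cycleIndex ι R σ * cycleIndex ι R τ := by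
  rw [cycleIndex_eq_prod_Icc ι R σ (N := n + m) (by simp),
    cycleIndex_eq_prod_Icc ι R τ (N := n + m) (by simp),
    cycleIndex_eq_prod_Icc ι R (intransitive σ τ) (N := n + m) (by simp),
    ← Finset.prod_mul_distrib]
  simp only [cycCount_intransitive, pow_add]

open scoped Classical in
/-- Multiplicativity of the cycle index on intransitive products of permutation groups:
`Σ_{σ ∈ G₁} Σ_{τ ∈ G₂} 𝔷(σ →⁺ τ) = (Σ_{σ ∈ G₁} 𝔷(σ)) · (Σ_{τ ∈ G₂} 𝔷(τ))`, i.e. over `ℚ`,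
`Z(G₁ →⁺ G₂) = Z(G₁) · Z(G₂)`. -/
theorem cycleIndex_intransitive_subgroup (R : Type*) [CommRing R] (ι : Type*) [Fintype ι]
    (n m : ℕ) (G₁ : Subgroup (Equiv.Perm (Fin n))) (G₂ : Subgroup (Equiv.Perm (Fin m))) :
    ∑ σ : G₁, ∑ τ : G₂, cycleIndex ι R (intransitive (σ : Equiv.Perm (Fin n)) (τ : Equiv.Perm (Fin m)))
      = (∑ σ : G₁, cycleIndex ι R (σ : Equiv.Perm (Fin n)))
        * (∑ τ : G₂, cycleIndex ι R (τ : Equiv.Perm (Fin m))) := by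
  simp only [cycleIndex_intransitive, Finset.sum_mul_sum]
end

section
/- Expansion of the cycle index of the Cartesian product of two symmetric groups: for all n, m ∈ ℕ and any finite type ι, in MvPolynomial ι ℚ one has (1/(n!·m!)) Σ_{σ ∈ Perm (Fin n)} Σ_{τ ∈ Perm (Fin m)} 𝔷(Equiv.prodCongr σ τ) = Σ_{λ ⊢ n} Σ_{ρ ⊢ m} (1/(z_λ · z_ρ)) ∏_{i} ∏_{j} (p_{lcm(λ_i, ρ_j)})^{gcd(λ_i, ρ_j)}, where the outer sums range over all partitions λ of n and ρ of m, the inner product is over all parts λ_i of λ and ρ_j of ρ (with multiplicity), and z_λ = ∏_i i^{n_i} · n_i! where n_i is the number of parts of λ equal to i. -/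
/-- `z_λ = ∏_i i^{n_i} · n_i!`, where `n_i` is the number of parts of the partition `λ`
equal to `i`. -/
def zCoeff {k : ℕ} (lam : Nat.Partition k) : ℕ :=
  ∏ i ∈ Finset.Icc 1 k, i ^ (lam.parts.count i) * Nat.factorial (lam.parts.count i)

open Function in
/-- The points of period `j` of a permutation are those lying on its orbits of size `j`. -/
theorem mul_cycCount {γ : Type*} [Fintype γ] (π : Equiv.Perm γ) (j : ℕ) :
    j * cycCount π j = Nat.card {x : γ // minimalPeriod π x = j} := by
  classical
  have horb (x : γ) : Nat.card (MulAction.orbitRel.Quotient.orbit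
      (Quotient.mk'' x : MulAction.orbitRel.Quotient (Subgroup.zpowers π) γ)) =
        minimalPeriod π x := by
    rw [MulAction.orbitRel.Quotient.orbit_mk, Nat.card_eq_fintype_card]
    exact (MulAction.minimalPeriod_eq_card π x).symm
  let e : {x : γ // minimalPeriod π x = j} ≃
      Σ ω : {ω : MulAction.orbitRel.Quotient (Subgroup.zpowers π) γ // Nat.card ω.orbit = j},
        ω.1.orbit :=
    { toFun x := ⟨⟨Quotient.mk'' x.1, (horb x).trans x.2⟩,
        ⟨x.1, MulAction.orbitRel.Quotient.mem_orbit.2 rfl⟩⟩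
      invFun y := ⟨y.2.1, by
        have h := MulAction.orbitRel.Quotient.mem_orbit.1 y.2.2
        rw [← horb, h]
        exact y.1.2⟩
      left_inv _ := rfl
      right_inv := by
        rintro ⟨⟨ω, hω⟩, ⟨x, hx⟩⟩
        obtain rfl := MulAction.orbitRel.Quotient.mem_orbit.1 hx
        rfl }
  rw [Nat.card_congr e, Nat.card_sigma, Finset.sum_congr rfl fun ω _ => ω.2,
    Finset.sum_const, Finset.card_univ, ← Nat.card_eq_fintype_card, smul_eq_mul, mul_comm,
    cycCount]

open Function in
theorem Equiv.Perm.minimalPeriod_eq_card_support_cycleOf {α : Type*} [Fintype α] [DecidableEq α]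
    (σ : Equiv.Perm α) {x : α} (hx : σ x ≠ x) :
    minimalPeriod σ x = (σ.cycleOf x).support.card := by
  have hc := σ.isCycle_cycleOf hx
  rw [← hc.orderOf]
  refine Nat.dvd_right_iff_eq.mp fun k => ?_
  rw [← isPeriodicPt_iff_minimalPeriod_dvd, orderOf_dvd_iff_pow_eq_one,
    hc.pow_eq_one_iff' (x := x) (by rwa [Equiv.Perm.cycleOf_apply_self]),
    Equiv.Perm.cycleOf_pow_apply_self, IsPeriodicPt, IsFixedPt, Equiv.Perm.iterate_eq_pow]

open Function in
theorem Equiv.Perm.mul_count_parts_partition {α : Type*} [Fintype α] [DecidableEq α]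
    (σ : Equiv.Perm α) (j : ℕ) :
    j * σ.partition.parts.count j = Nat.card {x : α // minimalPeriod σ x = j} := by
  rw [Nat.card_eq_fintype_card, Fintype.card_subtype, Equiv.Perm.parts_partition,
    Multiset.count_add, Multiset.count_replicate]
  by_cases h1 : j = 1
  · subst h1
    have h0 : σ.cycleType.count 1 = 0 :=
      Multiset.count_eq_zero.2 fun h => (Equiv.Perm.one_lt_of_mem_cycleType h).ne rfl
    rw [h0, if_pos rfl, zero_add, one_mul, ← Finset.card_compl]
    congr 1
    ext x
    simp [minimalPeriod_eq_one_iff_isFixedPt, IsFixedPt]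
  · rw [if_neg (Ne.symm h1), add_zero, Equiv.Perm.cycleType_def, Multiset.count_map]
    have hunion : (Finset.univ.filter fun x => minimalPeriod σ x = j) =
        (σ.cycleFactorsFinset.filter fun c => j = c.support.card).biUnion
          Equiv.Perm.support := by
      ext x
      simp only [Finset.mem_filter, Finset.mem_univ, true_and, Finset.mem_biUnion]
      constructor
      · intro h
        have hx : σ x ≠ x := fun hx =>
          h1 (h.symm.trans (minimalPeriod_eq_one_iff_isFixedPt.2 hx))
        refine ⟨σ.cycleOf x, ⟨?_, ?_⟩, ?_⟩
        · rwa [Equiv.Perm.cycleOf_mem_cycleFactorsFinset_iff, Equiv.Perm.mem_support]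
        · rw [← σ.minimalPeriod_eq_card_support_cycleOf hx, h]
        · rw [Equiv.Perm.mem_support_cycleOf_iff' hx]
      · rintro ⟨c, ⟨hc, rfl⟩, hx⟩
        have hxσ := Equiv.Perm.mem_cycleFactorsFinset_support_le hc hx
        rw [Equiv.Perm.cycle_is_cycleOf hx hc]
        exact σ.minimalPeriod_eq_card_support_cycleOf (Equiv.Perm.mem_support.1 hxσ)
    rw [hunion, Finset.card_biUnion, Finset.sum_congr rfl
      (fun c hc => (Finset.mem_filter.1 hc).2.symm), Finset.sum_const, smul_eq_mul, mul_comm]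
    · rfl
    · intro c hc d hd hcd
      rw [onFun, ← Equiv.Perm.disjoint_iff_disjoint_support]
      exact σ.cycleFactorsFinset_pairwise_disjoint (Finset.mem_filter.1 hc).1
        (Finset.mem_filter.1 hd).1 hcd

open Function in
theorem Equiv.Perm.minimalPeriod_mem_parts_partition {α : Type*} [Fintype α] [DecidableEq α]
    (σ : Equiv.Perm α) (x : α) : minimalPeriod σ x ∈ σ.partition.parts := by
  rw [← Multiset.count_pos]
  refine Nat.pos_of_mul_pos_left (a := minimalPeriod σ x) ?_
  rw [σ.mul_count_parts_partition]
  exact Nat.card_pos_iff.2 ⟨⟨x, rfl⟩, inferInstance⟩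

open Function in
theorem cycCount_prodCongr_s14 {α β : Type*} [Fintype α] [Fintype β] [DecidableEq α] [DecidableEq β]
    (σ : Equiv.Perm α) (τ : Equiv.Perm β) {k : ℕ} (hk : 0 < k) :
    cycCount (Equiv.prodCongr σ τ) k =
      ∑ a ∈ σ.partition.parts.toFinset, ∑ b ∈ τ.partition.parts.toFinset,
        if Nat.lcm a b = k then
          Nat.gcd a b * τ.partition.parts.count b * σ.partition.parts.count a else 0 := by
  refine Nat.eq_of_mul_eq_mul_left hk ?_
  rw [mul_cycCount, Nat.card_eq_fintype_card, Fintype.card_subtype,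
    Finset.card_eq_sum_card_fiberwise (t := σ.partition.parts.toFinset ×ˢ
      τ.partition.parts.toFinset)
      (f := fun x => (minimalPeriod σ x.1, minimalPeriod τ x.2)), Finset.sum_product,
    Finset.mul_sum]
  · refine Finset.sum_congr rfl fun a _ => ?_
    rw [Finset.mul_sum]
    refine Finset.sum_congr rfl fun b _ => ?_
    have hper (x : α × β) : minimalPeriod (Equiv.prodCongr σ τ) x =
        (minimalPeriod σ x.1).lcm (minimalPeriod τ x.2) := minimalPeriod_prodMap σ τ x
    split_ifs with h
    · have hset : ((Finset.univ.filter fun x => minimalPeriod (Equiv.prodCongr σ τ) x = k).filter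
          fun x => (minimalPeriod σ x.1, minimalPeriod τ x.2) = (a, b)) =
          (Finset.univ.filter fun x => minimalPeriod σ x = a) ×ˢ
            (Finset.univ.filter fun x => minimalPeriod τ x = b) := by
        ext x
        simp only [hper, Finset.mem_filter, Finset.mem_univ, true_and, Finset.mem_product,
          Prod.mk.injEq]
        constructor
        · exact fun hx => hx.2
        · rintro ⟨rfl, rfl⟩
          exact ⟨h, rfl, rfl⟩
      rw [hset, Finset.card_product, ← Fintype.card_subtype, ← Fintype.card_subtype,
        ← Nat.card_eq_fintype_card, ← Nat.card_eq_fintype_card,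
        ← Equiv.Perm.mul_count_parts_partition, ← Equiv.Perm.mul_count_parts_partition, ← h]
      calc _ = (a * b) * (σ.partition.parts.count a * τ.partition.parts.count b) := by ring
        _ = _ := by rw [← Nat.gcd_mul_lcm a b]; ring
    · rw [mul_zero, Finset.card_eq_zero, Finset.filter_eq_empty_iff]
      intro x hx hab
      rw [Finset.mem_filter, hper] at hx
      simp only [Prod.mk.injEq] at hab
      rw [hab.1, hab.2] at hx
      exact h hx.2
  · intro x _
    simp [Equiv.Perm.minimalPeriod_mem_parts_partition]

theorem cycleIndex_prodCongr (ι R : Type*) [Fintype ι] [CommRing R]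
    {α β : Type*} [Fintype α] [Fintype β] [DecidableEq α] [DecidableEq β]
    (σ : Equiv.Perm α) (τ : Equiv.Perm β) :
    cycleIndex ι R (Equiv.prodCongr σ τ) =
      (σ.partition.parts.bind fun a => τ.partition.parts.map fun b =>
        (MvPolynomial.psum ι R (Nat.lcm a b)) ^ (Nat.gcd a b)).prod := by
  rw [Multiset.prod_bind, Finset.prod_multiset_map_count, cycleIndex]
  calc
    _ = ∏ k ∈ Finset.Icc 1 (Fintype.card (α × β)), ∏ a ∈ σ.partition.parts.toFinset,
          ∏ b ∈ τ.partition.parts.toFinset, if Nat.lcm a b = k then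
            MvPolynomial.psum ι R k ^ (Nat.gcd a b * τ.partition.parts.count b *
              σ.partition.parts.count a) else 1 := by
      refine Finset.prod_congr rfl fun k hk => ?_
      rw [cycCount_prodCongr_s14 σ τ (Finset.mem_Icc.1 hk).1, ← Finset.prod_pow_eq_pow_sum]
      refine Finset.prod_congr rfl fun a _ => ?_
      rw [← Finset.prod_pow_eq_pow_sum]
      refine Finset.prod_congr rfl fun b _ => ?_
      split_ifs <;> simp
    _ = _ := by
      rw [Finset.prod_comm]
      refine Finset.prod_congr rfl fun a ha => ?_
      rw [Finset.prod_comm, Finset.prod_multiset_map_count, ← Finset.prod_pow]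
      refine Finset.prod_congr rfl fun b hb => ?_
      rw [Multiset.mem_toFinset] at ha hb
      have hmem : Nat.lcm a b ∈ Finset.Icc 1 (Fintype.card (α × β)) := by
        have ha' := σ.partition.parts_pos ha
        have hb' := τ.partition.parts_pos hb
        rw [Finset.mem_Icc, Fintype.card_prod]
        exact ⟨Nat.lcm_pos ha' hb', (Nat.le_of_dvd (Nat.mul_pos ha' hb')
          (Nat.lcm_dvd_mul a b)).trans (Nat.mul_le_mul (Nat.Partition.le_of_mem_parts ha)
            (Nat.Partition.le_of_mem_parts hb))⟩
      rw [Finset.prod_ite_eq, if_pos hmem, pow_mul, pow_mul]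

theorem Nat.Partition.parts_eq_filter_add_replicate {n : ℕ} (lam : n.Partition) :
    lam.parts = lam.parts.filter (2 ≤ ·) + Multiset.replicate (lam.parts.count 1) 1 := by
  rw [← Multiset.filter_eq' lam.parts 1]
  conv_lhs => rw [← Multiset.filter_add_not (2 ≤ ·) lam.parts]
  congr 1
  refine Multiset.filter_congr fun a ha => ?_
  have := lam.parts_pos ha
  omega

open Nat in
theorem zCoeff_eq {n : ℕ} (lam : n.Partition) :
    zCoeff lam = (n - (lam.parts.filter (2 ≤ ·)).sum)! * (lam.parts.filter (2 ≤ ·)).prod *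
      ∏ i ∈ (lam.parts.filter (2 ≤ ·)).toFinset, ((lam.parts.filter (2 ≤ ·)).count i)! := by
  have hparts := lam.parts_eq_filter_add_replicate
  set μ := lam.parts.filter (2 ≤ ·) with hμ
  set r := lam.parts.count 1 with hr
  have hsub : lam.parts.toFinset ⊆ Finset.Icc 1 n := fun a ha => by
    rw [Multiset.mem_toFinset] at ha
    exact Finset.mem_Icc.2 ⟨lam.parts_pos ha, Nat.Partition.le_of_mem_parts ha⟩
  have hsub' : μ.toFinset ⊆ Finset.Icc 1 n := fun a ha => hsub <| by
    rw [Multiset.mem_toFinset] at ha ⊢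
    exact Multiset.mem_of_mem_filter ha
  have hsum : n - μ.sum = r := by
    have h := lam.parts_sum
    rw [hparts, Multiset.sum_add, Multiset.sum_replicate, smul_eq_mul, mul_one] at h
    omega
  have hpow : ∏ i ∈ Finset.Icc 1 n, i ^ lam.parts.count i = μ.prod := by
    rw [← Finset.prod_multiset_count_of_subset _ _ hsub, hparts, Multiset.prod_add,
      Multiset.prod_replicate, one_pow, mul_one]
  have hfact : ∏ i ∈ Finset.Icc 1 n, (lam.parts.count i)! =
      r ! * ∏ i ∈ μ.toFinset, (μ.count i)! := by
    rw [Finset.prod_subset hsub' (f := fun i => (μ.count i)!) fun i _ hi => by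
      rw [Multiset.mem_toFinset] at hi
      rw [Multiset.count_eq_zero.2 hi, Nat.factorial_zero]]
    have hite : r ! = ∏ i ∈ Finset.Icc 1 n, if i = 1 then r ! else 1 := by
      rw [Finset.prod_ite_eq']
      split_ifs with h1
      · rfl
      · rw [hr, Multiset.count_eq_zero.2 fun h => h1 (hsub (Multiset.mem_toFinset.2 h)),
          Nat.factorial_zero]
    rw [hite, ← Finset.prod_mul_distrib]
    refine Finset.prod_congr rfl fun i _ => ?_
    split_ifs with h
    · subst h
      rw [hμ, Multiset.count_filter_of_neg (by norm_num), ← hr, Nat.factorial_zero, mul_one]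
    · conv_lhs => rw [hparts]
      rw [Multiset.count_add, Multiset.count_replicate, if_neg (Ne.symm h), add_zero, one_mul]
  rw [zCoeff, Finset.prod_mul_distrib, hpow, hfact, hsum]
  ring

/-- The partition of `n` given by the cycle lengths of a permutation of `Fin n`. -/
def finCyclePartition {n : ℕ} (σ : Equiv.Perm (Fin n)) : n.Partition where
  parts := σ.partition.parts
  parts_pos := σ.partition.parts_pos
  parts_sum := σ.partition.parts_sum.trans (Fintype.card_fin n)

theorem finCyclePartition_eq_iff {n : ℕ} (σ : Equiv.Perm (Fin n)) (lam : n.Partition) :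
    finCyclePartition σ = lam ↔ σ.cycleType = lam.parts.filter (2 ≤ ·) := by
  constructor
  · rintro rfl
    exact Equiv.Perm.filter_parts_partition_eq_cycleType.symm
  · intro h
    have h' : (finCyclePartition σ).parts.filter (2 ≤ ·) = lam.parts.filter (2 ≤ ·) :=
      Equiv.Perm.filter_parts_partition_eq_cycleType.trans h
    have h₁ := (finCyclePartition σ).parts_eq_filter_add_replicate
    have h₂ := lam.parts_eq_filter_add_replicate
    have hs₁ := congrArg Multiset.sum h₁
    have hs₂ := congrArg Multiset.sum h₂
    rw [Nat.Partition.parts_sum, Multiset.sum_add, Multiset.sum_replicate, smul_eq_mul,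
      mul_one] at hs₁ hs₂
    have hc : (finCyclePartition σ).parts.count 1 = lam.parts.count 1 := by
      rw [h'] at hs₁
      omega
    rw [Nat.Partition.ext_iff, h₁, h₂, h', hc]

open Nat in
theorem card_finCyclePartition_mul_zCoeff {n : ℕ} (lam : n.Partition) :
    (Finset.univ.filter fun σ : Equiv.Perm (Fin n) => finCyclePartition σ = lam).card *
      zCoeff lam = n ! := by
  have hle : (lam.parts.filter (2 ≤ ·)).sum ≤ n := by
    have hs := congrArg Multiset.sum lam.parts_eq_filter_add_replicate
    rw [lam.parts_sum, Multiset.sum_add] at hs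
    omega
  have h := Equiv.Perm.card_of_cycleType_mul_eq (Fin n) (lam.parts.filter (2 ≤ ·))
  rw [Fintype.card_fin, if_pos ⟨hle, fun a ha => (Multiset.mem_filter.1 ha).2⟩] at h
  simp only [finCyclePartition_eq_iff, zCoeff_eq, ← h]

open Nat in
/-- Averaging a class function over the symmetric group. -/
theorem inv_factorial_smul_sum_perm {M : Type*} [AddCommGroup M] [Module ℚ M] {n : ℕ}
    (f : n.Partition → M) :
    (n ! : ℚ)⁻¹ • ∑ σ : Equiv.Perm (Fin n), f (finCyclePartition σ) =
      ∑ lam : n.Partition, (zCoeff lam : ℚ)⁻¹ • f lam := by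
  rw [← Finset.sum_fiberwise Finset.univ finCyclePartition, Finset.smul_sum]
  refine Finset.sum_congr rfl fun lam _ => ?_
  rw [Finset.sum_congr rfl fun σ hσ => congrArg f (Finset.mem_filter.1 hσ).2,
    Finset.sum_const, ← Nat.cast_smul_eq_nsmul ℚ, smul_smul]
  congr 1
  have h := card_finCyclePartition_mul_zCoeff lam
  have hn := n.factorial_ne_zero
  have hz : (zCoeff lam : ℚ) ≠ 0 := Nat.cast_ne_zero.2 fun hz => hn (by rw [← h, hz, mul_zero])
  rw [inv_mul_eq_iff_eq_mul₀ (Nat.cast_ne_zero.2 hn), ← h, Nat.cast_mul,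
    mul_inv_cancel_right₀ hz]

/-- Expansion of the cycle index of the Cartesian product of two symmetric groups:
`Z(S_n ⊠ S_m) = h_n ⋆ h_m = Σ_{λ ⊢ n} Σ_{ρ ⊢ m} (1/(z_λ z_ρ)) ∏_{i,j} ψ_{λ_i ∨ ρ_j}^{λ_i ∧ ρ_j}`. -/
theorem cycleIndex_cartesian_symmetricGroups (n m : ℕ) (ι : Type*) [Fintype ι] :
    ((Nat.factorial n * Nat.factorial m : ℚ))⁻¹ •
        ∑ σ : Equiv.Perm (Fin n), ∑ τ : Equiv.Perm (Fin m),
          cycleIndex ι ℚ (Equiv.prodCongr σ τ)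
      = ∑ lam : Nat.Partition n, ∑ rho : Nat.Partition m,
          ((zCoeff lam * zCoeff rho : ℚ))⁻¹ •
            ((lam.parts.bind fun a => rho.parts.map fun b =>
                (MvPolynomial.psum ι ℚ (Nat.lcm a b)) ^ (Nat.gcd a b))).prod := by
  have h (lam : n.Partition) := inv_factorial_smul_sum_perm fun rho : m.Partition =>
    (lam.parts.bind fun a => rho.parts.map fun b =>
      (MvPolynomial.psum ι ℚ (Nat.lcm a b)) ^ (Nat.gcd a b)).prod
  simp only [cycleIndex_prodCongr, mul_inv, mul_smul, ← Finset.smul_sum, ← h]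
  rw [Finset.smul_sum (r := (m.factorial : ℚ)⁻¹), ← inv_factorial_smul_sum_perm]
  rfl
end

section
/- Decomposition of weighted bipartite graphs into their packed core (counting version): fix q ≥ 1 and n, m ∈ ℕ. Consider the action of Perm (Fin n) × Perm (Fin m) on matrices A : Fin n → Fin m → Fin q given by ((σ,τ)·A) i j = A (σ⁻¹ i) (τ⁻¹ j). Then the number of orbits of this action equals 1 + Σ_{k=1}^{n} Σ_{p=1}^{m} N(k,p), where N(k,p) is the number of orbits of the analogous action of Perm (Fin k) × Perm (Fin p) on the set of packed matrices B : Fin k → Fin p → Fin q (those in which every row and every column contains a nonzero entry). -/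
/-- The action of `Perm (Fin n) × Perm (Fin m)` on matrices `A : Fin n → Fin m → Fin q`
(weighted bipartite graphs) given by `((σ,τ)·A) i j = A (σ⁻¹ i) (τ⁻¹ j)`. -/
instance matrixAction (n m q : ℕ) :
    MulAction (Equiv.Perm (Fin n) × Equiv.Perm (Fin m)) (Fin n → Fin m → Fin q) where
  smul g A := fun i j => A (g.1⁻¹ i) (g.2⁻¹ j)
  one_smul A := by
    funext i j
    show A ((1 : Equiv.Perm (Fin n))⁻¹ i) ((1 : Equiv.Perm (Fin m))⁻¹ j) = A i j
    simp
  mul_smul g h A := by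
    funext i j
    show A ((g.1 * h.1)⁻¹ i) ((g.2 * h.2)⁻¹ j) = A (h.1⁻¹ (g.1⁻¹ i)) (h.2⁻¹ (g.2⁻¹ j))
    simp [mul_inv_rev, Equiv.Perm.mul_apply]

/-- A matrix is packed if every row and every column contains a nonzero entry
(no isolated vertex in the corresponding bipartite graph). -/
def Packed {k p q : ℕ} [NeZero q] (B : Fin k → Fin p → Fin q) : Prop :=
  (∀ i, ∃ j, B i j ≠ 0) ∧ ∀ j, ∃ i, B i j ≠ 0

/-- The induced action of `Perm (Fin k) × Perm (Fin p)` on the set of packed matrices. -/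
instance packedMatrixAction (k p q : ℕ) [NeZero q] :
    MulAction (Equiv.Perm (Fin k) × Equiv.Perm (Fin p))
      {B : Fin k → Fin p → Fin q // Packed B} where
  smul g B := ⟨fun i j => B.val (g.1⁻¹ i) (g.2⁻¹ j), by
    obtain ⟨h1, h2⟩ := B.property
    constructor
    · intro i
      obtain ⟨j, hj⟩ := h1 (g.1⁻¹ i)
      exact ⟨g.2 j, by simpa using hj⟩
    · intro j
      obtain ⟨i, hi⟩ := h2 (g.2⁻¹ j)
      exact ⟨g.1 i, by simpa using hi⟩⟩
  one_smul B := Subtype.ext <| by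
    funext i j
    show B.val ((1 : Equiv.Perm (Fin k))⁻¹ i) ((1 : Equiv.Perm (Fin p))⁻¹ j) = B.val i j
    simp
  mul_smul g h B := Subtype.ext <| by
    funext i j
    show B.val ((g.1 * h.1)⁻¹ i) ((g.2 * h.2)⁻¹ j)
      = B.val (h.1⁻¹ (g.1⁻¹ i)) (h.2⁻¹ (g.2⁻¹ j))
    simp [mul_inv_rev, Equiv.Perm.mul_apply]

/-- `B` is a core of `A` if `A` arises from `B` by relabelling the vertices and adding isolated
vertices. -/
def IsCore {n m k p q : ℕ} [NeZero q] (A : Fin n → Fin m → Fin q) (B : Fin k → Fin p → Fin q) :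
    Prop :=
  ∃ (f : Fin k ↪ Fin n) (g : Fin p ↪ Fin m), (∀ i j, A (f i) (g j) = B i j) ∧
    ∀ i j, A i j ≠ 0 → i ∈ Set.range f ∧ j ∈ Set.range g

theorem matrix_orbitRel_iff {n m q : ℕ} {A A' : Fin n → Fin m → Fin q} :
    MulAction.orbitRel (Equiv.Perm (Fin n) × Equiv.Perm (Fin m)) _ A A' ↔
      ∃ (σ : Equiv.Perm (Fin n)) (τ : Equiv.Perm (Fin m)), ∀ i j, A (σ i) (τ j) = A' i j := by
  rw [MulAction.orbitRel_apply]
  constructor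
  · rintro ⟨g, rfl⟩
    refine ⟨g.1, g.2, fun i j => ?_⟩
    show A' (g.1⁻¹ (g.1 i)) (g.2⁻¹ (g.2 j)) = A' i j
    simp
  · rintro ⟨σ, τ, h⟩
    refine ⟨(σ, τ), ?_⟩
    funext i j
    show A' (σ⁻¹ i) (τ⁻¹ j) = A i j
    simp [← h]

theorem packed_orbitRel_iff {k p q : ℕ} [NeZero q]
    {B B' : {B : Fin k → Fin p → Fin q // Packed B}} :
    MulAction.orbitRel (Equiv.Perm (Fin k) × Equiv.Perm (Fin p)) _ B B' ↔
      ∃ (σ : Equiv.Perm (Fin k)) (τ : Equiv.Perm (Fin p)),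
        ∀ i j, B.val (σ i) (τ j) = B'.val i j := by
  rw [← matrix_orbitRel_iff, MulAction.orbitRel_apply, MulAction.orbitRel_apply]
  exact exists_congr fun g => Subtype.ext_iff

namespace IsCore

variable {n m k p k' p' q : ℕ} [NeZero q] {A A' : Fin n → Fin m → Fin q}
  {B : Fin k → Fin p → Fin q} {B' : Fin k' → Fin p' → Fin q}

theorem of_perm_left (h : IsCore A B) (σ : Equiv.Perm (Fin n)) (τ : Equiv.Perm (Fin m))
    (hA : ∀ i j, A' (σ i) (τ j) = A i j) : IsCore A' B := by
  obtain ⟨f, g, hB, hs⟩ := h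
  refine ⟨f.trans σ.toEmbedding, g.trans τ.toEmbedding, fun i j => by simp [hA, hB],
    fun i j hij => ?_⟩
  obtain ⟨i, rfl⟩ := σ.surjective i
  obtain ⟨j, rfl⟩ := τ.surjective j
  rw [hA] at hij
  obtain ⟨⟨a, rfl⟩, b, rfl⟩ := hs i j hij
  exact ⟨⟨a, rfl⟩, b, rfl⟩

theorem of_perm_right {B' : Fin k → Fin p → Fin q} (h : IsCore A B) (σ : Equiv.Perm (Fin k))
    (τ : Equiv.Perm (Fin p)) (hB' : ∀ i j, B (σ i) (τ j) = B' i j) : IsCore A B' := by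
  obtain ⟨f, g, hB, hs⟩ := h
  refine ⟨σ.toEmbedding.trans f, τ.toEmbedding.trans g, fun i j => by simp [hB', hB],
    fun i j hij => ?_⟩
  obtain ⟨⟨a, rfl⟩, b, rfl⟩ := hs i j hij
  exact ⟨⟨σ⁻¹ a, by simp⟩, τ⁻¹ b, by simp⟩

/-- Matrices of the same size with a common core lie in the same orbit. -/
theorem exists_perm_of_common_core (h : IsCore A B) (h' : IsCore A' B) :
    ∃ (σ : Equiv.Perm (Fin n)) (τ : Equiv.Perm (Fin m)), ∀ i j, A (σ i) (τ j) = A' i j := by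
  obtain ⟨f, g, hB, hs⟩ := h
  obtain ⟨f', g', hB', hs'⟩ := h'
  obtain ⟨σ, hσ⟩ :=
    (Equiv.Perm.isMultiplyPretransitive (Fin n) k).exists_smul_eq f' f
  obtain ⟨τ, hτ⟩ :=
    (Equiv.Perm.isMultiplyPretransitive (Fin m) p).exists_smul_eq g' g
  have hσ' : ∀ i, σ (f' i) = f i := fun i => DFunLike.congr_fun hσ i
  have hτ' : ∀ i, τ (g' i) = g i := fun i => DFunLike.congr_fun hτ i
  refine ⟨σ, τ, fun i j => ?_⟩
  by_cases hij : A' i j = 0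
  · by_contra hne
    rw [hij] at hne
    obtain ⟨⟨a, ha⟩, b, hb⟩ := hs _ _ hne
    rw [← hσ', σ.apply_eq_iff_eq] at ha
    rw [← hτ', τ.apply_eq_iff_eq] at hb
    subst ha hb
    rw [hσ', hτ', hB, ← hB', hij] at hne
    exact hne rfl
  · obtain ⟨⟨a, rfl⟩, b, rfl⟩ := hs' i j hij
    rw [hB', hσ', hτ', hB]

/-- The rows indexed by a packed core are exactly the nonzero rows, and likewise for columns. -/
theorem range_eq_support {f : Fin k ↪ Fin n} {g : Fin p ↪ Fin m} (hP : Packed B)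
    (hB : ∀ i j, A (f i) (g j) = B i j)
    (hs : ∀ i j, A i j ≠ 0 → i ∈ Set.range f ∧ j ∈ Set.range g) :
    Set.range f = {i | ∃ j, A i j ≠ 0} ∧ Set.range g = {j | ∃ i, A i j ≠ 0} := by
  constructor
  · refine Set.Subset.antisymm ?_ fun i ⟨j, hij⟩ => (hs i j hij).1
    rintro _ ⟨i, rfl⟩
    obtain ⟨j, hj⟩ := hP.1 i
    exact ⟨g j, by rwa [hB]⟩
  · refine Set.Subset.antisymm ?_ fun j ⟨i, hij⟩ => (hs i j hij).2
    rintro _ ⟨j, rfl⟩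
    obtain ⟨i, hi⟩ := hP.2 j
    exact ⟨f i, by rwa [hB]⟩

theorem exists_equiv_of_range_eq {f : Fin k ↪ Fin n} {f' : Fin k' ↪ Fin n}
    (h : Set.range f = Set.range f') : ∃ e : Fin k' ≃ Fin k, ∀ i, f (e i) = f' i := by
  refine ⟨((Equiv.ofInjective f' f'.injective).trans (Equiv.setCongr h.symm)).trans
    (Equiv.ofInjective f f.injective).symm, fun i => ?_⟩
  simp [Equiv.apply_ofInjective_symm]

/-- Packed cores are unique up to relabelling. -/
theorem exists_equiv_of_packed (h : IsCore A B) (h' : IsCore A B') (hP : Packed B)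
    (hP' : Packed B') :
    ∃ (σ : Fin k' ≃ Fin k) (τ : Fin p' ≃ Fin p), ∀ i j, B (σ i) (τ j) = B' i j := by
  obtain ⟨f, g, hB, hs⟩ := h
  obtain ⟨f', g', hB', hs'⟩ := h'
  have hr := range_eq_support hP hB hs
  have hr' := range_eq_support hP' hB' hs'
  obtain ⟨σ, hσ⟩ := exists_equiv_of_range_eq (hr.1.trans hr'.1.symm)
  obtain ⟨τ, hτ⟩ := exists_equiv_of_range_eq (hr.2.trans hr'.2.symm)
  exact ⟨σ, τ, fun i j => by rw [← hB, ← hB', hσ, hτ]⟩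

end IsCore

theorem exists_packed_isCore {n m q : ℕ} [NeZero q] (A : Fin n → Fin m → Fin q) :
    ∃ (k : Fin (n + 1)) (p : Fin (m + 1)) (B : {B : Fin k → Fin p → Fin q // Packed B}),
      IsCore A B.val := by
  classical
  let R : Finset (Fin n) := {i | ∃ j, A i j ≠ 0}
  let C : Finset (Fin m) := {j | ∃ i, A i j ≠ 0}
  have hR : R.card < n + 1 := Nat.lt_succ_of_le (by simpa using R.card_le_univ)
  have hC : C.card < m + 1 := Nat.lt_succ_of_le (by simpa using C.card_le_univ)
  let f := R.orderEmbOfFin rfl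
  let g := C.orderEmbOfFin rfl
  have hf : ∀ i, i ∈ Set.range f ↔ ∃ j, A i j ≠ 0 := fun i => by simp [f, R]
  have hg : ∀ j, j ∈ Set.range g ↔ ∃ i, A i j ≠ 0 := fun j => by simp [g, C]
  refine ⟨⟨R.card, hR⟩, ⟨C.card, hC⟩, ⟨fun i j => A (f i) (g j), fun i => ?_, fun j => ?_⟩,
    f.toEmbedding, g.toEmbedding, fun i j => rfl,
    fun i j hij => ⟨(hf i).2 ⟨j, hij⟩, (hg j).2 ⟨i, hij⟩⟩⟩
  · obtain ⟨j, hj⟩ := (hf (f i)).1 ⟨i, rfl⟩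
    obtain ⟨b, rfl⟩ := (hg j).2 ⟨_, hj⟩
    exact ⟨b, hj⟩
  · obtain ⟨i, hi⟩ := (hg (g j)).1 ⟨j, rfl⟩
    obtain ⟨a, rfl⟩ := (hf i).2 ⟨_, hi⟩
    exact ⟨a, hi⟩

theorem exists_isCore_of_le {n m k p q : ℕ} [NeZero q] (hk : k ≤ n) (hp : p ≤ m)
    (B : Fin k → Fin p → Fin q) : ∃ A : Fin n → Fin m → Fin q, IsCore A B := by
  refine ⟨fun i j => if h : i < k ∧ j < p then B ⟨i, h.1⟩ ⟨j, h.2⟩ else 0,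
    Fin.castLEEmb hk, Fin.castLEEmb hp, fun i j => by simp, fun i j hij => ?_⟩
  have h : i.val < k ∧ j.val < p := by
    by_contra h
    simp [h] at hij
  exact ⟨⟨⟨i, h.1⟩, rfl⟩, ⟨j, h.2⟩, rfl⟩

/-- Orbits of packed matrices of size `k × p`. -/
abbrev PackedOrbit (q k p : ℕ) [NeZero q] : Type :=
  MulAction.orbitRel.Quotient (Equiv.Perm (Fin k) × Equiv.Perm (Fin p))
    {B : Fin k → Fin p → Fin q // Packed B}

theorem card_orbits_eq_card_sigma (q : ℕ) [NeZero q] (n m : ℕ) :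
    Nat.card (MulAction.orbitRel.Quotient (Equiv.Perm (Fin n) × Equiv.Perm (Fin m))
        (Fin n → Fin m → Fin q))
      = Nat.card (Σ k : Fin (n + 1), Σ p : Fin (m + 1), PackedOrbit q k p) := by
  choose K P B hB using fun A : Fin n → Fin m → Fin q => exists_packed_isCore A
  have sigma_eq : ∀ (k k' : Fin (n + 1)) (p p' : Fin (m + 1))
      (C : {B : Fin k → Fin p → Fin q // Packed B})
      (C' : {B : Fin k' → Fin p' → Fin q // Packed B}) (A : Fin n → Fin m → Fin q),
      IsCore A C.val → IsCore A C'.val →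
      (⟨k, p, Quotient.mk _ C⟩ : Σ k : Fin (n + 1), Σ p : Fin (m + 1), PackedOrbit q k p)
        = ⟨k', p', Quotient.mk _ C'⟩ := by
    intro k k' p p' C C' A h h'
    obtain ⟨σ, τ, hC⟩ := h.exists_equiv_of_packed h' C.property C'.property
    obtain rfl : k' = k := Fin.ext (Fin.equiv_iff_eq.1 ⟨σ⟩)
    obtain rfl : p' = p := Fin.ext (Fin.equiv_iff_eq.1 ⟨τ⟩)
    rw [Quotient.sound (packed_orbitRel_iff.2 ⟨σ, τ, hC⟩)]
  refine Nat.card_eq_of_bijective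
    (Quotient.lift (fun A => ⟨K A, P A, Quotient.mk _ (B A)⟩) fun A A' h => ?_) ⟨?_, ?_⟩
  · obtain ⟨σ, τ, h⟩ := matrix_orbitRel_iff.1 h
    exact sigma_eq _ _ _ _ _ _ A (hB A) ((hB A').of_perm_left σ τ h)
  · rintro ⟨A⟩ ⟨A'⟩ h
    refine Quotient.sound (matrix_orbitRel_iff.2 ?_)
    have core_of_eq : ∀ x y : (Σ k : Fin (n + 1), Σ p : Fin (m + 1), PackedOrbit q k p),
        x = y → ∀ C C', x.2.2 = Quotient.mk _ C → y.2.2 = Quotient.mk _ C' →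
        IsCore A C.val → IsCore A C'.val := by
      rintro x _ rfl C C' hC hC' hA
      obtain ⟨σ, τ, h⟩ := packed_orbitRel_iff.1 (Quotient.exact (hC.symm.trans hC'))
      exact hA.of_perm_right σ τ h
    exact (core_of_eq _ _ h (B A) (B A') rfl rfl (hB A)).exists_perm_of_common_core (hB A')
  · rintro ⟨k, p, ⟨C⟩⟩
    obtain ⟨A, hA⟩ := exists_isCore_of_le (Nat.le_of_lt_succ k.2) (Nat.le_of_lt_succ p.2) C.val
    exact ⟨Quotient.mk _ A, sigma_eq _ _ _ _ _ _ A (hB A) hA⟩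

theorem card_packedOrbit_zero_zero (q : ℕ) [NeZero q] : Nat.card (PackedOrbit q 0 0) = 1 := by
  rw [Nat.card_eq_one_iff_unique]
  refine ⟨⟨?_⟩, ⟨Quotient.mk _ ⟨fun i => i.elim0, fun i => i.elim0, fun j => j.elim0⟩⟩⟩
  rintro ⟨B⟩ ⟨B'⟩
  exact congrArg _ (Subsingleton.elim B B')

theorem card_packedOrbit_zero_left (q p : ℕ) [NeZero q] (hp : 1 ≤ p) :
    Nat.card (PackedOrbit q 0 p) = 0 := by
  have : IsEmpty (PackedOrbit q 0 p) := ⟨by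
    rintro ⟨B⟩
    exact (B.property.2 ⟨0, hp⟩).choose.elim0⟩
  exact Nat.card_of_isEmpty

theorem card_packedOrbit_zero_right (q k : ℕ) [NeZero q] (hk : 1 ≤ k) :
    Nat.card (PackedOrbit q k 0) = 0 := by
  have : IsEmpty (PackedOrbit q k 0) := ⟨by
    rintro ⟨B⟩
    exact (B.property.1 ⟨0, hk⟩).choose.elim0⟩
  exact Nat.card_of_isEmpty

theorem sum_range_succ_eq_add_sum_Icc (f : ℕ → ℕ) (n : ℕ) :
    ∑ k ∈ Finset.range (n + 1), f k = f 0 + ∑ k ∈ Finset.Icc 1 n, f k := by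
  rw [Finset.range_eq_Ico, Finset.sum_eq_sum_Ico_succ_bot n.succ_pos]
  rfl

/-- Every weighted bipartite graph decomposes uniquely into a packed core together with
isolated vertices: the number of orbits of `Perm (Fin n) × Perm (Fin m)` acting on all
matrices `Fin n → Fin m → Fin q` equals `1` (for the all-zero matrix) plus the sum over
`1 ≤ k ≤ n`, `1 ≤ p ≤ m` of the numbers of orbits of packed matrices. -/
theorem card_orbits_eq_sum_card_packed_orbits (q : ℕ) [NeZero q] (n m : ℕ) :
    Nat.card (MulAction.orbitRel.Quotient (Equiv.Perm (Fin n) × Equiv.Perm (Fin m))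
        (Fin n → Fin m → Fin q))
      = 1 + ∑ k ∈ Finset.Icc 1 n, ∑ p ∈ Finset.Icc 1 m,
          Nat.card (MulAction.orbitRel.Quotient (Equiv.Perm (Fin k) × Equiv.Perm (Fin p))
            {B : Fin k → Fin p → Fin q // Packed B}) := by
  rw [card_orbits_eq_card_sigma]
  simp only [Nat.card_sigma]
  rw [Fin.sum_univ_eq_sum_range
    (fun k => ∑ p : Fin (m + 1), Nat.card (PackedOrbit q k p)) (n + 1),
    sum_range_succ_eq_add_sum_Icc]
  have hsum : ∀ k, ∑ p : Fin (m + 1), Nat.card (PackedOrbit q k p)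
      = Nat.card (PackedOrbit q k 0) + ∑ p ∈ Finset.Icc 1 m, Nat.card (PackedOrbit q k p) :=
    fun k => by
      rw [Fin.sum_univ_eq_sum_range (fun p => Nat.card (PackedOrbit q k p)) (m + 1),
        sum_range_succ_eq_add_sum_Icc]
  congr 1
  · rw [hsum, card_packedOrbit_zero_zero, Finset.sum_eq_zero fun p hp =>
      card_packedOrbit_zero_left q p (Finset.mem_Icc.1 hp).1, add_zero]
  · refine Finset.sum_congr rfl fun k hk => ?_
    rw [hsum, card_packedOrbit_zero_right q k (Finset.mem_Icc.1 hk).1, zero_add]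
end
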